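/- arXiv:math/0402399 — 2 statements merged into one kernel-verified Lean document; each statement's English description precedes it below -/
import Mathlib

section
/- Let (W_j)_{j≥1} and (σ_j)_{j≥1} be two sequences of random variables on a probability space such that all the variables W_1, σ_1, W_2, σ_2, ... are jointly independent, each W_j has the Beta(1,1/2) distribution (Lebesgue density w ↦ (1/2)(1−w)^{-1/2} on (0,1)), and each σ_j has the stable(1/2) distribution (Lebesgue density s ↦ (2π)^{-1/2} s^{-3/2} exp(−1/(2s)) on (0,∞)). Define the stick-breaking sequence Q_j := W_j · ∏_{i<j} (1 − W_i), set L_j := sqrt(Q_j/σ_j), and L := Σ_{j≥1} L_j. Then: (i) L converges (is finite) almost surely and P(L > ℓ) = exp(−ℓ^2/2) for all ℓ ≥ 0; and (ii) the normalized sequence (L_j/L)_{j≥1} is independent of L and has the same law (as a random sequence) as the uniform stick-breaking sequence (U_j · ∏_{i<j}(1 − U_i))_{j≥1} built from i.i.d. uniform(0,1) variables U_j, i.e. the GEM(1) distribution. -/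
open MeasureTheory ProbabilityTheory Real

lemma ftc_Ioo {a b A B : ℝ} (hab : a < b) {F f : ℝ → ℝ}
    (hd : ∀ x ∈ Set.Ioo a b, HasDerivAt F (f x) x) (hf : ∀ x ∈ Set.Ioo a b, 0 ≤ f x)
    (hA : Filter.Tendsto F (nhdsWithin a (Set.Ioi a)) (nhds A))
    (hB : Filter.Tendsto F (nhdsWithin b (Set.Iio b)) (nhds B)) :
    ∫⁻ x in Set.Ioo a b, ENNReal.ofReal (f x) = ENNReal.ofReal (B - A) := by
  set G := extendFrom (Set.Ioo a b) F with hG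
  have hFc : ContinuousOn F (Set.Ioo a b) := fun x hx => (hd x hx).continuousAt.continuousWithinAt
  have hGc : ContinuousOn G (Set.Icc a b) := continuousOn_Icc_extendFrom_Ioo hFc hA hB
  have hGa : G a = A := eq_lim_at_left_extendFrom_Ioo hab hA
  have hGb : G b = B := eq_lim_at_right_extendFrom_Ioo hab hB
  have hGF : ∀ x ∈ Set.Ioo a b, G x = F x := fun x hx =>
    extendFrom_eq (subset_closure hx) (hFc x hx)
  have hGd : ∀ x ∈ Set.Ioo a b, HasDerivAt G (f x) x := by
    intro x hx
    refine (hd x hx).congr_of_eventuallyEq ?_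
    filter_upwards [isOpen_Ioo.mem_nhds hx] with y hy using hGF y hy
  have hi := intervalIntegral.integrableOn_deriv_of_nonneg hGc hGd hf
  have := intervalIntegral.integral_eq_sub_of_hasDerivAt_of_le hab.le hGc hGd
    ((intervalIntegrable_iff_integrableOn_Ioc_of_le hab.le).2 hi)
  rw [intervalIntegral.integral_of_le hab.le, integral_Ioc_eq_integral_Ioo, hGa, hGb] at this
  rw [← this, ofReal_integral_eq_lintegral_ofReal]
  · exact hi.mono_set Set.Ioo_subset_Ioc_self
  · exact (ae_restrict_iff' measurableSet_Ioo).2 (Filter.Eventually.of_forall hf)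

noncomputable def PhiG (z : ℝ) : ℝ := ∫ u in (0:ℝ)..z, Real.exp (-u^2/2)

lemma PhiG_deriv (z : ℝ) : HasDerivAt PhiG (Real.exp (-z^2/2)) z := by
  have hc : Continuous fun u : ℝ => Real.exp (-u^2/2) := by fun_prop
  exact intervalIntegral.integral_hasDerivAt_right (hc.intervalIntegrable _ _)
    (hc.stronglyMeasurableAtFilter _ _) hc.continuousAt

lemma PhiG_top : Filter.Tendsto PhiG Filter.atTop (nhds (√(2*π)/2)) := by
  have h1 : (fun u : ℝ => Real.exp (-u^2/2)) = fun u => Real.exp (-(1/2) * u^2) := by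
    ext u; congr 1; ring
  have hi : Integrable fun u : ℝ => Real.exp (-u^2/2) := by
    rw [h1]; exact integrable_exp_neg_mul_sq (by norm_num)
  have := intervalIntegral_tendsto_integral_Ioi 0 hi.integrableOn Filter.tendsto_id
  have h2 : ∫ x in Set.Ioi (0:ℝ), Real.exp (-x^2/2) = √(2*π)/2 := by
    rw [h1, integral_gaussian_Ioi]
    congr 2; field_simp
  rw [h2] at this
  exact this

lemma PhiG_neg (z : ℝ) : PhiG (-z) = - PhiG z := by
  unfold PhiG
  have := intervalIntegral.integral_comp_neg (a := 0) (b := z) (fun u : ℝ => Real.exp (-u^2/2))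
  simp only [neg_sq, neg_zero] at this
  rw [this, intervalIntegral.integral_symm]

lemma PhiG_bot : Filter.Tendsto PhiG Filter.atBot (nhds (-(√(2*π)/2))) := by
  have := (PhiG_top.comp Filter.tendsto_neg_atBot_atTop).neg
  refine this.congr fun z => ?_
  simp [PhiG_neg]

lemma q_deriv (c d w : ℝ) (hw : w ∈ Set.Ioo (0:ℝ) 1) :
    HasDerivAt (fun w => (c * w + d) / √(w * (1-w)))
      ((c * w + d * (2 * w - 1) + 0) / (2 * (w * (1-w)) * √(w * (1-w))) ) w := by
  obtain ⟨h0, h1⟩ := hw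
  have hq : 0 < w * (1-w) := mul_pos h0 (by linarith)
  have hs : HasDerivAt (fun w : ℝ => √(w * (1-w))) ((1 * (1-w) + w * (0-1)) / (2 * √(w*(1-w)))) w :=
    ((hasDerivAt_id w).mul ((hasDerivAt_const w 1).sub (hasDerivAt_id w))).sqrt hq.ne'
  have hn : HasDerivAt (fun w : ℝ => c * w + d) c w := by
    simpa using ((hasDerivAt_id w).const_mul c).add_const d
  refine (hn.div hs (Real.sqrt_pos.2 hq).ne').congr_deriv ?_
  have hs2 : √(w*(1-w))^2 = w * (1-w) := Real.sq_sqrt hq.le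
  have hsp := Real.sqrt_pos.2 hq
  set s := √(w*(1-w))
  rw [← hs2]
  field_simp
  have : s^2 = w * (1-w) := hs2
  rw [this]
  ring

lemma inv_sqrt_zero : Filter.Tendsto (fun w : ℝ => (√(w * (1-w)))⁻¹)
    (nhdsWithin 0 (Set.Ioi 0)) Filter.atTop := by
  refine Filter.Tendsto.inv_tendsto_nhdsGT_zero ?_
  refine tendsto_nhdsWithin_iff.2 ⟨?_, ?_⟩
  · have : Continuous fun w : ℝ => √(w * (1-w)) := by fun_prop
    simpa using (this.tendsto 0).mono_left nhdsWithin_le_nhds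
  · filter_upwards [Ioo_mem_nhdsGT (zero_lt_one (α := ℝ))] with w hw
    exact Real.sqrt_pos.2 (mul_pos hw.1 (by linarith [hw.2]))

lemma inv_sqrt_one : Filter.Tendsto (fun w : ℝ => (√(w * (1-w)))⁻¹)
    (nhdsWithin 1 (Set.Iio 1)) Filter.atTop := by
  refine Filter.Tendsto.inv_tendsto_nhdsGT_zero ?_
  refine tendsto_nhdsWithin_iff.2 ⟨?_, ?_⟩
  · have : Continuous fun w : ℝ => √(w * (1-w)) := by fun_prop
    simpa using (this.tendsto 1).mono_left nhdsWithin_le_nhds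
  · filter_upwards [Ioo_mem_nhdsLT (zero_lt_one (α := ℝ))] with w hw
    exact Real.sqrt_pos.2 (mul_pos hw.1 (by linarith [hw.2]))

lemma lin_tendsto (c d a : ℝ) (s : Set ℝ) :
    Filter.Tendsto (fun w => c * w + d) (nhdsWithin a s) (nhds (c * a + d)) := by
  have : Continuous fun w : ℝ => c * w + d := by fun_prop
  exact (this.tendsto a).mono_left nhdsWithin_le_nhds

lemma w_int {x y : ℝ} (hx : 0 < x) (hy : 0 < y) :
    ∫⁻ w in Set.Ioo (0:ℝ) 1, ENNReal.ofReal (y * w / (w * (1-w) * √(w * (1-w))) / √(2*π) *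
      Real.exp (-(x^2/w + y^2/(1-w))/2)) = ENNReal.ofReal (Real.exp (-(x+y)^2/2)) := by
  set p : ℝ → ℝ := fun w => ((x+y) * w + -x) / √(w * (1-w)) with hp
  set r : ℝ → ℝ := fun w => ((y-x) * w + x) / √(w * (1-w)) with hr
  have hc2 : 0 < √(2*π) := by positivity
  have key := ftc_Ioo (a := 0) (b := 1) (by norm_num)
    (F := fun w => (Real.exp (-(x+y)^2/2) * PhiG (p w) + Real.exp (-(x-y)^2/2) * PhiG (r w)) / √(2*π))
    (f := fun w => y * w / (w * (1-w) * √(w * (1-w))) / √(2*π) *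
      Real.exp (-(x^2/w + y^2/(1-w))/2))
    (A := (Real.exp (-(x+y)^2/2) * (-(√(2*π)/2)) + Real.exp (-(x-y)^2/2) * (√(2*π)/2)) / √(2*π))
    (B := (Real.exp (-(x+y)^2/2) * ((√(2*π)/2)) + Real.exp (-(x-y)^2/2) * (√(2*π)/2)) / √(2*π))
    ?_ ?_ ?_ ?_
  · rw [key]; congr 1; field_simp; ring
  · intro w hw
    have h1 := ((PhiG_deriv (p w)).comp w (q_deriv (x+y) (-x) w hw)).const_mul (Real.exp (-(x+y)^2/2))
    have h2 := ((PhiG_deriv (r w)).comp w (q_deriv (y-x) (x) w hw)).const_mul (Real.exp (-(x-y)^2/2))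
    obtain ⟨hw0, hw1⟩ := hw
    have hw1' : 0 < 1 - w := by linarith
    have hq : 0 < w * (1-w) := mul_pos hw0 hw1'
    refine ((h1.add h2).div_const (√(2*π))).congr_deriv ?_
    rw [← mul_assoc (rexp (-(x+y)^2/2)), ← mul_assoc (rexp (-(x-y)^2/2)), ← Real.exp_add,
      ← Real.exp_add]
    have e1 : -(x + y) ^ 2 / 2 + -p w ^ 2 / 2 = -(x^2/w + y^2/(1-w))/2 := by
      simp only [hp, div_pow, Real.sq_sqrt hq.le]; field_simp; ring
    have e2 : -(x - y) ^ 2 / 2 + -r w ^ 2 / 2 = -(x^2/w + y^2/(1-w))/2 := by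
      simp only [hr, div_pow, Real.sq_sqrt hq.le]; field_simp; ring
    rw [e1, e2]
    have := Real.sqrt_pos.2 hq
    field_simp
    ring
  · rintro w ⟨hw0, hw1⟩
    have hw1' : 0 < 1 - w := by linarith
    positivity
  · have hp0 : Filter.Tendsto p (nhdsWithin 0 (Set.Ioi 0)) Filter.atBot :=
      (lin_tendsto (x+y) (-x) 0 _).neg_mul_atTop (by linarith) inv_sqrt_zero
    have hr0 : Filter.Tendsto r (nhdsWithin 0 (Set.Ioi 0)) Filter.atTop :=
      (lin_tendsto (y-x) x 0 _).pos_mul_atTop (by linarith) inv_sqrt_zero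
    exact (((PhiG_bot.comp hp0).const_mul _).add ((PhiG_top.comp hr0).const_mul _)).div_const _
  · have hp0 : Filter.Tendsto p (nhdsWithin 1 (Set.Iio 1)) Filter.atTop :=
      (lin_tendsto (x+y) (-x) 1 _).pos_mul_atTop (by linarith) inv_sqrt_one
    have hr0 : Filter.Tendsto r (nhdsWithin 1 (Set.Iio 1)) Filter.atTop :=
      (lin_tendsto (y-x) x 1 _).pos_mul_atTop (by linarith) inv_sqrt_one
    exact (((PhiG_top.comp hp0).const_mul _).add ((PhiG_top.comp hr0).const_mul _)).div_const _

lemma lint_wd {s : Set ℝ} (hs : MeasurableSet s) {g : ℝ → ℝ} (hg : Measurable g)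
    {f : ℝ → ENNReal} (hf : Measurable f) :
    ∫⁻ x, f x ∂(volume.withDensity fun w => ENNReal.ofReal (Set.indicator s g w)) =
      ∫⁻ x in s, ENNReal.ofReal (g x) * f x := by
  rw [lintegral_withDensity_eq_lintegral_mul _ (by measurability) hf, ← lintegral_indicator hs]
  refine lintegral_congr fun x => ?_
  by_cases hx : x ∈ s <;> simp [hx]

noncomputable def bW : Measure ℝ := volume.withDensity fun w =>
      ENNReal.ofReal (Set.indicator (Set.Ioo (0:ℝ) 1)
        (fun w => (1/2) * (1 - w) ^ (-(1:ℝ)/2)) w)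

noncomputable def bS : Measure ℝ := volume.withDensity fun s =>
      ENNReal.ofReal (Set.indicator (Set.Ioi (0:ℝ))
        (fun s => (2 * π) ^ (-(1:ℝ)/2) * s ^ (-(3:ℝ)/2) * Real.exp (-1 / (2 * s))) s)

noncomputable def mRay : Measure ℝ := volume.withDensity fun s =>
      ENNReal.ofReal (Set.indicator (Set.Ioi (0:ℝ))
        (fun r => r * Real.exp (-r^2 / 2)) s)

noncomputable def un : Measure ℝ := volume.restrict (Set.Ioo (0:ℝ) 1)

lemma R_law {w : ℝ} (hw : w < 1) {h : ℝ → ENNReal} (hh : Measurable h) :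
    ∫⁻ r, h (√(1-w) * r) ∂mRay =
      ∫⁻ y in Set.Ioi (0:ℝ), ENNReal.ofReal (y/(1-w) * Real.exp (-(y^2/(1-w))/2)) * h y := by
  have hs : 0 < √(1-w) := Real.sqrt_pos.2 (by linarith)
  have hs2 : √(1-w)^2 = 1-w := Real.sq_sqrt (by linarith)
  suffices H : ∀ c : ℝ, 0 < c → ∫⁻ r, h (c * r) ∂mRay =
      ∫⁻ y in Set.Ioi (0:ℝ), ENNReal.ofReal (y/c^2 * Real.exp (-(y^2/c^2)/2)) * h y by
    have := H _ hs
    rwa [hs2] at this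
  clear hs2 hs
  intro c hs
  rw [mRay, lint_wd measurableSet_Ioi (by fun_prop) (f := fun r => h (c * r)) (by fun_prop)]
  have him : (fun y => y / c) '' Set.Ioi (0:ℝ) = Set.Ioi 0 := by
    ext r; constructor
    · rintro ⟨y, hy, rfl⟩; exact div_pos hy hs
    · intro hr; exact ⟨c * r, mul_pos hs hr, by field_simp⟩
  have := lintegral_image_eq_lintegral_abs_deriv_mul (s := Set.Ioi (0:ℝ)) (f := fun y => y / c)
    (f' := fun y => 1 / c) measurableSet_Ioi
    (fun x _ => ((hasDerivAt_id x).div_const c).hasDerivWithinAt)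
    (fun a _ b _ hab => by simpa [hs.ne'] using hab)
    (fun r => ENNReal.ofReal (r * Real.exp (-r^2/2)) * h (c * r))
  rw [him] at this
  rw [this]
  refine setLIntegral_congr_fun measurableSet_Ioi fun y (hy : 0 < y) => ?_
  beta_reduce
  rw [← mul_assoc, ← ENNReal.ofReal_mul (by positivity), mul_div_cancel₀ _ hs.ne',
    abs_of_pos (by positivity)]
  congr 2
  rw [div_pow]
  ring_nf

lemma S_law {w : ℝ} (hw : 0 < w) {h : ℝ → ENNReal} (hh : Measurable h) :
    ∫⁻ s, h (√(w / s)) ∂bS =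
      ∫⁻ x in Set.Ioi (0:ℝ), ENNReal.ofReal (2 / (√(2*π) * √w) * Real.exp (-(x^2/w)/2)) * h x := by
  rw [bS, lint_wd measurableSet_Ioi (by fun_prop) (f := fun s => h (√(w/s))) (by fun_prop)]
  have him : (fun x => w / x^2) '' Set.Ioi (0:ℝ) = Set.Ioi 0 := by
    ext r; constructor
    · rintro ⟨y, hy, rfl⟩
      have : 0 < y := hy
      exact div_pos hw (by positivity)
    · intro hr
      have hr' : 0 < r := hr
      refine ⟨√(w/r), Real.sqrt_pos.2 (div_pos hw hr), ?_⟩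
      beta_reduce
      rw [Real.sq_sqrt (by positivity)]
      field_simp
  have := lintegral_image_eq_lintegral_abs_deriv_mul (s := Set.Ioi (0:ℝ)) (f := fun x => w / x^2)
    (f' := fun x => - (2 * w / x^3)) measurableSet_Ioi
    (fun x (hx : 0 < x) => by
      refine HasDerivAt.hasDerivWithinAt ?_
      refine ((hasDerivAt_const x w).div ((hasDerivAt_id x).pow 2)
        (by simp [hx.ne'])).congr_deriv ?_
      simp only [id]
      field_simp
      norm_num
      try ring)
    (fun a (ha : 0 < a) b (hb : 0 < b) hab => by
      simp only at hab
      have : a^2 = b^2 := by field_simp at hab; exact hab.symm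
      exact (pow_left_inj₀ ha.le hb.le (by norm_num)).1 this)
    (fun s => ENNReal.ofReal ((2 * π) ^ (-(1:ℝ)/2) * s ^ (-(3:ℝ)/2) * Real.exp (-1 / (2 * s))) *
      h (√(w/s)))
  rw [him] at this
  rw [this]
  refine setLIntegral_congr_fun measurableSet_Ioi fun x (hx : 0 < x) => ?_
  beta_reduce
  have e1 : √(w / (w / x^2)) = x := by
    rw [div_div_cancel₀ hw.ne', Real.sqrt_sq hx.le]
  rw [← mul_assoc, ← ENNReal.ofReal_mul (by positivity), e1, abs_neg, abs_of_pos (by positivity)]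
  congr 2
  have e2 : (2 * π) ^ (-(1:ℝ)/2) = 1 / √(2*π) := by
    rw [Real.sqrt_eq_rpow, neg_div, Real.rpow_neg (by positivity), one_div, one_div]
  have e3 : (w / x^2) ^ (-(3:ℝ)/2) = x^3 / (w * √w) := by
    rw [neg_div, Real.rpow_neg (by positivity), show (3:ℝ)/2 = 1 + 1/2 by norm_num,
      Real.rpow_add (by positivity), Real.rpow_one, ← Real.sqrt_eq_rpow, Real.sqrt_div hw.le,
      Real.sqrt_sq hx.le]
    field_simp
  have e4 : -1 / (2 * (w / x^2)) = -(x^2/w)/2 := by field_simp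
  rw [e2, e3, e4]
  field_simp

lemma lhs_law {f : ℝ × ℝ → ENNReal} (hf : Measurable f) :
    ∫⁻ w, ∫⁻ s, ∫⁻ r, f (√(w/s), √(1-w) * r) ∂mRay ∂bS ∂bW =
    ∫⁻ x in Set.Ioi (0:ℝ), ∫⁻ y in Set.Ioi (0:ℝ), ENNReal.ofReal (Real.exp (-(x+y)^2/2)) * f (x,y) := by
  have : SFinite mRay := by unfold mRay; infer_instance
  have : SFinite bS := by unfold bS; infer_instance
  rw [bW, lint_wd measurableSet_Ioo (by fun_prop)
    (f := fun w => ∫⁻ s, ∫⁻ r, f (√(w/s), √(1-w) * r) ∂mRay ∂bS)]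
  swap
  · refine Measurable.lintegral_prod_right' (f := fun p : ℝ × ℝ => ∫⁻ r, f (√(p.1/p.2), √(1-p.1) * r) ∂mRay) ?_
    refine Measurable.lintegral_prod_right' (f := fun p : (ℝ × ℝ) × ℝ => f (√(p.1.1/p.1.2), √(1-p.1.1) * p.2)) ?_
    fun_prop
  calc _ = ∫⁻ w in Set.Ioo (0:ℝ) 1, ∫⁻ x in Set.Ioi (0:ℝ), ∫⁻ y in Set.Ioi (0:ℝ),
        ENNReal.ofReal (y * w / (w * (1-w) * √(w * (1-w))) / √(2*π) *
      Real.exp (-(x^2/w + y^2/(1-w))/2)) * f (x,y) := by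
        refine setLIntegral_congr_fun measurableSet_Ioo fun w hw => ?_
        obtain ⟨hw0, hw1⟩ := hw
        have hw1' : 0 < 1 - w := by linarith
        beta_reduce
        rw [S_law hw0 (h := fun x => ∫⁻ r, f (x, √(1-w) * r) ∂mRay)]
        swap
        · refine Measurable.lintegral_prod_right' (f := fun p : ℝ × ℝ => f (p.1, √(1-w) * p.2)) ?_
          fun_prop
        rw [← lintegral_const_mul']
        swap
        · exact ENNReal.ofReal_ne_top
        refine setLIntegral_congr_fun measurableSet_Ioi fun x (hx : 0 < x) => ?_
        beta_reduce
        rw [R_law hw1 (h := fun y => f (x, y)) (by fun_prop), ← lintegral_const_mul' _ _ ENNReal.ofReal_ne_top,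
          ← lintegral_const_mul' _ _ ENNReal.ofReal_ne_top]
        refine setLIntegral_congr_fun measurableSet_Ioi fun y (hy : 0 < y) => ?_
        beta_reduce
        rw [← mul_assoc, ← mul_assoc, ← ENNReal.ofReal_mul (by positivity), ← ENNReal.ofReal_mul (by positivity)]
        congr 2
        have e2 : (1-w) ^ (-(1:ℝ)/2) = 1 / √(1-w) := by
          rw [Real.sqrt_eq_rpow, neg_div, Real.rpow_neg (by positivity), one_div, one_div]
        rw [e2, Real.sqrt_mul hw0.le, neg_add, add_div, Real.exp_add]
        field_simp
    _ = ∫⁻ x in Set.Ioi (0:ℝ), ∫⁻ y in Set.Ioi (0:ℝ), ∫⁻ w in Set.Ioo (0:ℝ) 1,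
        ENNReal.ofReal (y * w / (w * (1-w) * √(w * (1-w))) / √(2*π) *
      Real.exp (-(x^2/w + y^2/(1-w))/2)) * f (x,y) := by
        rw [lintegral_lintegral_swap]
        · refine lintegral_congr fun x => ?_
          rw [lintegral_lintegral_swap]
          refine Measurable.aemeasurable ?_
          fun_prop
        · refine Measurable.aemeasurable ?_
          refine Measurable.lintegral_prod_right' (f := fun p : (ℝ × ℝ) × ℝ =>
            ENNReal.ofReal (p.2 * p.1.1 / (p.1.1 * (1-p.1.1) * √(p.1.1 * (1-p.1.1))) / √(2*π) *
            Real.exp (-(p.1.2^2/p.1.1 + p.2^2/(1-p.1.1))/2)) * f (p.1.2,p.2)) ?_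
          fun_prop
    _ = _ := by
        refine setLIntegral_congr_fun measurableSet_Ioi fun x (hx : 0 < x) => ?_
        refine setLIntegral_congr_fun measurableSet_Ioi fun y (hy : 0 < y) => ?_
        beta_reduce
        rw [lintegral_mul_const _ (by fun_prop), w_int hx hy]

lemma rhs_law {f : ℝ × ℝ → ENNReal} (hf : Measurable f) :
    ∫⁻ r, ∫⁻ u, f (r * u, r * (1-u)) ∂un ∂mRay =
    ∫⁻ x in Set.Ioi (0:ℝ), ∫⁻ y in Set.Ioi (0:ℝ), ENNReal.ofReal (Real.exp (-(x+y)^2/2)) * f (x,y) := by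
  rw [mRay, lint_wd measurableSet_Ioi (by fun_prop) (f := fun r => ∫⁻ u, f (r * u, r * (1-u)) ∂un)]
  swap
  · have : SFinite un := by unfold un; infer_instance
    refine Measurable.lintegral_prod_right' (f := fun p : ℝ × ℝ => f (p.1 * p.2, p.1 * (1-p.2))) ?_
    fun_prop
  set g : ℝ → ℝ → ENNReal := fun r x => Set.indicator {p : ℝ × ℝ | 0 < p.2 ∧ p.2 < p.1}
    (fun p => ENNReal.ofReal (Real.exp (-p.1^2/2)) * f (p.2, p.1 - p.2)) (r, x) with hg
  have hms : MeasurableSet {p : ℝ × ℝ | 0 < p.2 ∧ p.2 < p.1} :=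
    (measurableSet_lt measurable_const measurable_snd).inter
      (measurableSet_lt measurable_snd measurable_fst)
  have hgm : Measurable (Function.uncurry g) := by
    have : Function.uncurry g = Set.indicator {p : ℝ × ℝ | 0 < p.2 ∧ p.2 < p.1}
      (fun p => ENNReal.ofReal (Real.exp (-p.1^2/2)) * f (p.2, p.1 - p.2)) := by
      ext ⟨a, b⟩; rfl
    rw [this]
    refine Measurable.indicator ?_ hms
    fun_prop
  calc _ = ∫⁻ r, ∫⁻ x, g r x := by
        rw [← lintegral_indicator measurableSet_Ioi]
        refine lintegral_congr fun r => ?_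
        by_cases hr : 0 < r
        swap
        · have : ∀ x, g r x = 0 := by
            intro x; simp only [hg]; rw [Set.indicator_of_notMem]
            rintro ⟨h1, h2⟩; simp only at h1 h2; linarith
          simp [this, hr]
        have him : (fun u => r * u) '' Set.Ioo (0:ℝ) 1 = Set.Ioo 0 r := by
          ext x; constructor
          · rintro ⟨u, hu, rfl⟩
            exact ⟨mul_pos hr hu.1, by simpa using mul_lt_mul_of_pos_left hu.2 hr⟩
          · intro hx
            exact ⟨x / r, ⟨div_pos hx.1 hr, (div_lt_one hr).2 hx.2⟩, by field_simp⟩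
        have := lintegral_image_eq_lintegral_abs_deriv_mul (s := Set.Ioo (0:ℝ) 1)
          (f := fun u => r * u) (f' := fun _ => r * 1) measurableSet_Ioo
          (fun x _ => ((hasDerivAt_id x).const_mul r).hasDerivWithinAt)
          (fun a _ b _ hab => by simpa [hr.ne'] using hab)
          (fun x => ENNReal.ofReal (Real.exp (-r^2/2)) * f (x, r - x))
        rw [him] at this
        have hgr : ∀ x, g r x = Set.indicator (Set.Ioo 0 r)
          (fun x => ENNReal.ofReal (Real.exp (-r^2/2)) * f (x, r - x)) x := by
          intro x; simp only [hg, Set.indicator, Set.mem_ofPred_eq, Set.mem_Ioo]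
        simp only [hgr]
        rw [lintegral_indicator measurableSet_Ioo, this, Set.indicator_of_mem (show r ∈ Set.Ioi 0 from hr), un,
          ← lintegral_const_mul' _ _ ENNReal.ofReal_ne_top]
        refine setLIntegral_congr_fun measurableSet_Ioo fun u hu => ?_
        beta_reduce
        rw [← mul_assoc, ← ENNReal.ofReal_mul (by positivity), mul_one, abs_of_pos hr, mul_sub, mul_one]
    _ = ∫⁻ x, ∫⁻ r, g r x := lintegral_lintegral_swap hgm.aemeasurable
    _ = ∫⁻ x, ∫⁻ y, g (x + y) x := by
        refine lintegral_congr fun x => ?_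
        exact (lintegral_add_left_eq_self (fun r => g r x) x).symm
    _ = _ := by
        rw [← lintegral_indicator measurableSet_Ioi]
        refine lintegral_congr fun x => ?_
        by_cases hx : 0 < x
        swap
        · have : ∀ y, g (x + y) x = 0 := by
            intro y; simp only [hg]; rw [Set.indicator_of_notMem]
            rintro ⟨h1, h2⟩; exact hx h1
          simp [this, hx]
        rw [Set.indicator_of_mem (show x ∈ Set.Ioi 0 from hx), ← lintegral_indicator measurableSet_Ioi]
        refine lintegral_congr fun y => ?_
        simp [hg, Set.indicator, hx]

instance : SFinite mRay := by unfold mRay; infer_instance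
instance : SFinite bW := by unfold bW; infer_instance
instance : SFinite bS := by unfold bS; infer_instance
instance : IsProbabilityMeasure un := ⟨by simp [un]⟩

lemma mRay_tail {l : ℝ} (hl : 0 ≤ l) :
    mRay (Set.Ioi l) = ENNReal.ofReal (Real.exp (-l^2/2)) := by
  have hd : ∀ x ∈ Set.Ici l, HasDerivAt (fun x : ℝ => - Real.exp (-x^2/2)) (x * Real.exp (-x^2/2)) x := by
    intro x _
    have h1 : HasDerivAt (fun x : ℝ => -x^2/2) (-x) x := by
      refine (((hasDerivAt_id x).pow 2).neg.div_const 2).congr_deriv ?_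
      simp
      ring
    refine h1.exp.neg.congr_deriv ?_
    ring
  have hp : ∀ x ∈ Set.Ioi l, 0 ≤ x * Real.exp (-x^2/2) := fun x hx =>
    mul_nonneg (hl.trans (le_of_lt hx)) (Real.exp_pos _).le
  have hlim : Filter.Tendsto (fun x : ℝ => - Real.exp (-x^2/2)) Filter.atTop (nhds (-0)) := by
    refine Filter.Tendsto.neg ?_
    refine Real.tendsto_exp_atBot.comp ?_
    have : Filter.Tendsto (fun x : ℝ => x^2/2) Filter.atTop Filter.atTop :=
      (Filter.tendsto_pow_atTop (by norm_num)).atTop_div_const (by norm_num)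
    refine (Filter.tendsto_neg_atTop_atBot.comp this).congr fun x => ?_
    simp [neg_div]
  have hI := integral_Ioi_of_hasDerivAt_of_nonneg' hd hp hlim
  have hint := integrableOn_Ioi_deriv_of_nonneg' hd hp hlim
  have h1 : mRay (Set.Ioi l) = ∫⁻ x, Set.indicator (Set.Ioi l) 1 x ∂mRay := by
    rw [lintegral_indicator_one measurableSet_Ioi]
  rw [h1, mRay, lint_wd measurableSet_Ioi (by fun_prop)
    (measurable_one.indicator measurableSet_Ioi)]
  have h2 : ∫⁻ x in Set.Ioi (0:ℝ), ENNReal.ofReal (x * Real.exp (-x^2/2)) *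
      Set.indicator (Set.Ioi l) 1 x = ∫⁻ x in Set.Ioi l, ENNReal.ofReal (x * Real.exp (-x^2/2)) := by
    rw [← lintegral_indicator measurableSet_Ioi, ← lintegral_indicator measurableSet_Ioi]
    refine lintegral_congr fun x => ?_
    by_cases hx : l < x
    · have : 0 < x := hl.trans_lt hx
      simp [hx, this]
    · simp [hx, Set.indicator]
  rw [h2, ← ofReal_integral_eq_lintegral_ofReal hint
    ((ae_restrict_iff' measurableSet_Ioi).2 (Filter.Eventually.of_forall hp)), hI]
  congr 1
  ring

lemma mRay_pos : ∀ᵐ r ∂mRay, 0 < r := by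
  rw [ae_iff, mRay, withDensity_apply _ (by measurability)]
  rw [setLIntegral_congr_fun (g := 0) (by measurability)]
  · simp
  · intro r hr
    have hr' : ¬ 0 < r := hr
    simp [Set.indicator, hr']

instance : IsProbabilityMeasure mRay := by
  refine ⟨?_⟩
  have h := mRay_tail (le_refl 0)
  have h2 : mRay Set.univ = mRay (Set.Ioi 0) := by
    refine measure_congr ?_
    filter_upwards [mRay_pos] with r hr
    exact propext ⟨fun _ => hr, fun _ => trivial⟩
  rw [h2, h]; simp

lemma bW_lt : ∀ᵐ r ∂bW, r < 1 := by
  rw [ae_iff, bW, withDensity_apply _ (by measurability)]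
  rw [setLIntegral_congr_fun (g := 0) (by measurability)]
  · simp
  · intro r hr
    have hr' : ¬ r < 1 := hr
    simp [Set.indicator, hr']

lemma one_step : ((bW.prod bS).prod mRay).map
      (fun p => (√(p.1.1/p.1.2), √(1-p.1.1) * p.2)) =
    (mRay.prod un).map (fun p => (p.1*p.2, p.1*(1-p.2))) := by
  refine Measure.ext_of_lintegral _ fun f hf => ?_
  rw [lintegral_map hf (by fun_prop), lintegral_map hf (by fun_prop),
    lintegral_prod _ (by fun_prop), lintegral_prod _ (by fun_prop),
    lintegral_prod _ (by fun_prop)]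
  exact (lhs_law hf).trans (rhs_law hf).symm

/-- Prepend a real number to a sequence. -/
def scons (a : ℝ) (x : ℕ → ℝ) : ℕ → ℝ
  | 0 => a
  | (n+1) => x n

lemma measurable_scons {α : Type*} [MeasurableSpace α] {a : α → ℝ} {x : α → ℕ → ℝ}
    (ha : Measurable a) (hx : Measurable x) : Measurable fun t => scons (a t) (x t) := by
  refine measurable_pi_iff.2 fun n => ?_
  cases n with
  | zero => exact ha
  | succ n => exact (measurable_pi_apply n).comp hx

noncomputable def gstep (p : (ℝ × ℝ) × (ℕ → ℝ)) : ℕ → ℝ :=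
  scons (√(p.1.1/p.1.2)) (fun n => √(1-p.1.1) * p.2 n)

lemma measurable_gstep : Measurable gstep := by
  refine measurable_scons (by fun_prop) ?_
  refine measurable_pi_iff.2 fun n => ?_
  fun_prop

noncomputable def trunc (n : ℕ) (x : ℕ → ℝ) : ℕ → ℝ := fun j => if j < n then x j else 0

lemma measurable_trunc (n : ℕ) : Measurable (trunc n) := by
  refine measurable_pi_iff.2 fun j => ?_
  unfold trunc
  by_cases h : j < n <;> simp only [h, if_true, if_false] <;> fun_prop

lemma trunc_gstep (n : ℕ) (p : (ℝ × ℝ) × (ℕ → ℝ)) :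
    trunc (n+1) (gstep p) = gstep (p.1, trunc n p.2) := by
  ext j
  cases j with
  | zero => simp [trunc, gstep, scons]
  | succ j => simp [trunc, gstep, scons]

lemma fixed_trunc {ρ : Measure (ℝ × ℝ)} [IsProbabilityMeasure ρ] {μ : Measure (ℕ → ℝ)}
    [IsProbabilityMeasure μ] (hμ : μ = (ρ.prod μ).map gstep) (n : ℕ) :
    μ.map (trunc (n+1)) = (ρ.prod (μ.map (trunc n))).map gstep := by
  have h1 : ρ.prod (μ.map (trunc n)) = (ρ.prod μ).map (Prod.map id (trunc n)) := by
    rw [← Measure.map_prod_map _ _ measurable_id (measurable_trunc n), Measure.map_id]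
  rw [h1, Measure.map_map measurable_gstep (measurable_id.prodMap (measurable_trunc n))]
  conv_lhs => rw [hμ]
  rw [Measure.map_map (measurable_trunc _) measurable_gstep]
  congr 1
  ext1 p
  exact trunc_gstep n p

lemma fixed_unique {ρ : Measure (ℝ × ℝ)} [IsProbabilityMeasure ρ] {μ ν : Measure (ℕ → ℝ)}
    [IsProbabilityMeasure μ] [IsProbabilityMeasure ν]
    (hμ : μ = (ρ.prod μ).map gstep) (hν : ν = (ρ.prod ν).map gstep) : μ = ν := by
  have key : ∀ n, μ.map (trunc n) = ν.map (trunc n) := by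
    intro n
    induction n with
    | zero =>
      have : trunc 0 = fun _ => 0 := by ext x j; simp [trunc]
      rw [this, Measure.map_const, Measure.map_const]; simp
    | succ n ih => rw [fixed_trunc hμ, fixed_trunc hν, ih]
  refine IsProjectiveLimit.unique (P := fun I => ν.map I.restrict) ?_ (fun I => rfl)
  intro I
  obtain ⟨n, hn⟩ : ∃ n, ∀ i ∈ I, i < n :=
    ⟨I.sup id + 1, fun i hi => Nat.lt_succ_of_le (Finset.le_sup (f := id) hi)⟩
  have h : (I.restrict : (ℕ → ℝ) → _) = I.restrict ∘ trunc n := by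
    ext x j
    simp [trunc, hn j j.2]
  change μ.map I.restrict = ν.map I.restrict
  rw [h, ← Measure.map_map (Finset.measurable_restrict I) (measurable_trunc n), key,
    Measure.map_map (Finset.measurable_restrict I) (measurable_trunc n)]

lemma indep_split {Ω ι κ κ' : Type*} [MeasurableSpace Ω] {P : Measure Ω} {X : ι → Ω → ℝ}
    (hX : ∀ i, Measurable (X i)) (h : iIndepFun X P) (a : κ → ι) (b : κ' → ι)
    (hab : ∀ k k', a k ≠ b k') :
    IndepFun (fun ω k => X (a k) ω) (fun ω k => X (b k) ω) P := by
  have hd : Disjoint (Set.range a) (Set.range b) := by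
    rw [Set.disjoint_left]
    rintro _ ⟨k, rfl⟩ ⟨k', hk⟩
    exact hab k k' hk.symm
  have := indep_iSup_of_disjoint (fun i => (hX i).comap_le) ((iIndepFun_iff_iIndep _ _ _).1 h) hd
  rw [IndepFun_iff_Indep]
  have gen : ∀ {η : Type _} (c : η → ι), MeasurableSpace.comap (fun ω k => X (c k) ω) MeasurableSpace.pi ≤
      ⨆ i ∈ Set.range c, MeasurableSpace.comap (X i) inferInstance := by
    intro η c
    simp only [MeasurableSpace.pi, MeasurableSpace.comap_iSup, MeasurableSpace.comap_comp]
    exact iSup_le fun k => le_iSup₂_of_le (c k) ⟨k, rfl⟩ le_rfl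
  have gen' : ∀ {η : Type _} (c : η → ι), MeasurableSpace.comap (fun ω k => X (c k) ω) MeasurableSpace.pi ≤
      ⨆ i ∈ Set.range c, MeasurableSpace.comap (X i) inferInstance := by
    intro η c
    simp only [MeasurableSpace.pi, MeasurableSpace.comap_iSup, MeasurableSpace.comap_comp]
    exact iSup_le fun k => le_iSup₂_of_le (c k) ⟨k, rfl⟩ le_rfl
  exact indep_of_indep_of_le_right (indep_of_indep_of_le_left this (gen a)) (gen' b)

def stick (U : ℕ → ℝ) (j : ℕ) : ℝ := U j * ∏ i ∈ Finset.range j, (1 - U i)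

lemma measurable_stick : Measurable stick := by
  refine measurable_pi_iff.2 fun j => ?_
  unfold stick
  fun_prop

lemma stick_succ (U : ℕ → ℝ) (j : ℕ) :
    stick U (j+1) = (1 - U 0) * stick (fun i => U (i+1)) j := by
  unfold stick
  rw [Finset.prod_range_succ']
  ring

noncomputable def piU : Measure (ℕ → ℝ) := Measure.infinitePi (fun _ => un)
instance : IsProbabilityMeasure piU := by unfold piU; infer_instance

lemma piU_indep : iIndepFun (fun (i : ℕ) (ω : ℕ → ℝ) => ω i) piU :=
  iIndepFun_infinitePi (P := fun _ : ℕ => un) (X := fun _ x => x) (fun _ => measurable_id)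

lemma piU_eval (i : ℕ) : piU.map (fun ω => ω i) = un := Measure.infinitePi_map_eval _ i

lemma piU_shift : piU = (un.prod piU).map (fun p => scons p.1 p.2) := by
  have h1 := indep_split (fun i => measurable_pi_apply i) piU_indep (fun _ : Unit => 0)
    (fun j : ℕ => j + 1) (by simp)
  have h2 : IndepFun (fun ω : ℕ → ℝ => ω 0) (fun ω k => ω (k+1)) piU :=
    h1.comp (φ := fun x : Unit → ℝ => x ()) (ψ := id) (measurable_pi_apply _) measurable_id
  have h3 := (indepFun_iff_map_prod_eq_prod_map_map (Measurable.aemeasurable (by fun_prop))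
    (Measurable.aemeasurable (by fun_prop))).1 h2
  have h4 : piU.map (fun ω k => ω (k+1)) = piU := by
    have := (piU_indep.precomp (g := fun k : ℕ => k + 1) (add_left_injective 1)).map_fun_eq_infinitePi_map
      (fun i => measurable_pi_apply _)
    simp only [Function.comp, piU_eval] at this
    exact this
  rw [piU_eval, h4] at h3
  rw [← h3, Measure.map_map (measurable_scons (by fun_prop) (by fun_prop)) (by fun_prop)]
  conv_lhs => rw [← Measure.map_id (μ := piU)]
  congr 1
  ext ω j
  cases j <;> rfl

lemma un_half : ∫⁻ u, ENNReal.ofReal (1-u) ∂un = ENNReal.ofReal (1/2) := by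
  have := ftc_Ioo (a := 0) (b := 1) (A := 0) (B := 1/2) (F := fun u => u - u^2/2)
    (f := fun u => 1 - u) (by norm_num) ?_ ?_ ?_ ?_
  · rw [un, this]; norm_num
  · intro x _
    refine ((hasDerivAt_id x).sub (((hasDerivAt_id x).pow 2).div_const 2)).congr_deriv ?_
    simp
  · intro x hx; linarith [hx.2]
  · have : Continuous fun u : ℝ => u - u^2/2 := by fun_prop
    simpa using (this.tendsto 0).mono_left nhdsWithin_le_nhds
  · have : Continuous fun u : ℝ => u - u^2/2 := by fun_prop
    have h := (this.tendsto 1).mono_left (nhdsWithin_le_nhds (s := Set.Iio 1))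
    norm_num at h
    norm_num
    exact h

lemma piU_prod (n : ℕ) : ∫⁻ U, ∏ i ∈ Finset.range n, ENNReal.ofReal (1 - U i) ∂piU =
    (ENNReal.ofReal (1/2))^n := by
  induction n with
  | zero => simp
  | succ n ih =>
    conv_lhs => rw [piU_shift]
    rw [lintegral_map (by fun_prop) (measurable_scons (by fun_prop) (by fun_prop))]
    simp only [Finset.prod_range_succ', scons]
    rw [lintegral_prod_symm' _ (by fun_prop)]
    simp only
    have : ∀ y : ℕ → ℝ, ∫⁻ x, (∏ k ∈ Finset.range n, ENNReal.ofReal (1 - y k)) * ENNReal.ofReal (1-x) ∂un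
      = (∏ k ∈ Finset.range n, ENNReal.ofReal (1 - y k)) * ENNReal.ofReal (1/2) := by
      intro y
      rw [lintegral_const_mul _ (by fun_prop), un_half]
    simp only [this]
    rw [lintegral_mul_const _ (by fun_prop), ih, pow_succ]

lemma sum_stick (U : ℕ → ℝ) (n : ℕ) :
    ∑ j ∈ Finset.range n, stick U j = 1 - ∏ i ∈ Finset.range n, (1 - U i) := by
  induction n with
  | zero => simp
  | succ n ih => rw [Finset.sum_range_succ, ih, Finset.prod_range_succ, stick]; ring

lemma piU_good : ∀ᵐ U ∂piU, (∀ j, 0 ≤ stick U j) ∧ HasSum (stick U) 1 := by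
  have h1 : ∀ᵐ U ∂piU, ∀ i, U i ∈ Set.Ioo (0:ℝ) 1 := by
    rw [ae_all_iff]
    intro i
    have : ∀ᵐ u ∂(piU.map (fun ω => ω i)), u ∈ Set.Ioo (0:ℝ) 1 := by
      rw [piU_eval]; exact ae_restrict_mem measurableSet_Ioo
    exact ae_of_ae_map (measurable_pi_apply i).aemeasurable this
  have h2 : ∀ᵐ U ∂piU, ∑' n, ∏ i ∈ Finset.range n, ENNReal.ofReal (1 - U i) < ⊤ := by
    refine ae_lt_top (by fun_prop) ?_
    rw [lintegral_tsum (fun n => Measurable.aemeasurable (by fun_prop))]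
    simp only [piU_prod]
    rw [ENNReal.tsum_geometric]
    simp
  filter_upwards [h1, h2] with U hU hU2
  have hn : ∀ j, 0 ≤ stick U j := fun j =>
    mul_nonneg (hU j).1.le (Finset.prod_nonneg fun i _ => by linarith [(hU i).2])
  refine ⟨hn, ?_⟩
  rw [hasSum_iff_tendsto_nat_of_nonneg hn]
  have h3 := ENNReal.tendsto_atTop_zero_of_tsum_ne_top hU2.ne
  have h4 := (ENNReal.tendsto_toReal ENNReal.zero_ne_top).comp h3
  have h5 : ∀ n, (∏ i ∈ Finset.range n, ENNReal.ofReal (1 - U i)).toReal = ∏ i ∈ Finset.range n, (1 - U i) := by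
    intro n
    rw [ENNReal.toReal_prod]
    refine Finset.prod_congr rfl fun i _ => ENNReal.toReal_ofReal (by linarith [(hU i).2])
  simp only [sum_stick]
  have h6 : Filter.Tendsto (fun n => ∏ i ∈ Finset.range n, (1 - U i)) Filter.atTop (nhds 0) := by
    refine h4.congr fun n => ?_
    exact h5 n
  simpa using h6.const_sub 1

noncomputable def nuL : Measure (ℕ → ℝ) := (mRay.prod piU).map (fun p j => p.1 * stick p.2 j)

lemma measurable_stick' (j : ℕ) : Measurable fun U => stick U j :=
  (measurable_pi_apply j).comp measurable_stick

lemma measurable_nuF : Measurable (fun (p : ℝ × (ℕ → ℝ)) (j : ℕ) => p.1 * stick p.2 j) := by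
  refine measurable_pi_iff.2 fun j => ?_
  exact measurable_fst.mul ((measurable_stick' j).comp measurable_snd)

instance : IsProbabilityMeasure nuL :=
  Measure.isProbabilityMeasure_map measurable_nuF.aemeasurable

lemma nu_fixed : nuL = ((bW.prod bS).prod nuL).map gstep := by
  set K : (ℝ × ℝ) × (ℕ → ℝ) → ℕ → ℝ := fun q => scons q.1.1 (fun j => q.1.2 * stick q.2 j) with hK
  have hKm : Measurable K := by
    refine measurable_scons (by fun_prop) ?_
    refine measurable_pi_iff.2 fun j => ?_
    exact (by fun_prop : Measurable fun q : (ℝ × ℝ) × (ℕ → ℝ) => q.1.2).mul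
      ((measurable_stick' j).comp measurable_snd)
  set A : (ℝ × ℝ) × ℝ → ℝ × ℝ := fun p => (√(p.1.1/p.1.2), √(1-p.1.1) * p.2) with hA
  set B : ℝ × ℝ → ℝ × ℝ := fun p => (p.1*p.2, p.1*(1-p.2)) with hB
  have hAm : Measurable A := by fun_prop
  have hBm : Measurable B := by fun_prop
  have step1 : ((bW.prod bS).prod nuL).map gstep =
      ((((bW.prod bS).prod mRay).map A).prod piU).map K := by
    have e1 : (bW.prod bS).prod nuL = ((bW.prod bS).prod (mRay.prod piU)).map
        (Prod.map id (fun p j => p.1 * stick p.2 j)) := by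
      rw [← Measure.map_prod_map _ _ measurable_id measurable_nuF, Measure.map_id, nuL]
    have e2 : (((bW.prod bS).prod mRay).map A).prod piU =
        (((bW.prod bS).prod mRay).prod piU).map (Prod.map A id) := by
      rw [← Measure.map_prod_map _ _ hAm measurable_id, Measure.map_id]
    rw [e1, e2, ← Measure.prodAssoc_prod, Measure.map_map measurable_gstep (measurable_id.prodMap measurable_nuF),
      Measure.map_map hKm (hAm.prodMap measurable_id), Measure.map_map
      (measurable_gstep.comp (measurable_id.prodMap measurable_nuF)) (MeasurableEquiv.measurable _)]
    congr 1
    ext p j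
    cases j with
    | zero => rfl
    | succ j =>
      simp [gstep, K, A, scons, MeasurableEquiv.prodAssoc, mul_assoc]
  have step2 : (((mRay.prod un).map B).prod piU).map K = nuL := by
    have e2 : ((mRay.prod un).map B).prod piU =
        ((mRay.prod un).prod piU).map (Prod.map B id) := by
      rw [← Measure.map_prod_map _ _ hBm measurable_id, Measure.map_id]
    have hsc : Measurable (fun p : ℝ × (ℕ → ℝ) => scons p.1 p.2) :=
      measurable_scons measurable_fst measurable_snd
    have e3 : mRay.prod piU = (mRay.prod (un.prod piU)).map (Prod.map id (fun p => scons p.1 p.2)) := by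
      rw [← Measure.map_prod_map _ _ measurable_id hsc, Measure.map_id, ← piU_shift]
    rw [nuL, e2, e3, ← Measure.prodAssoc_prod, Measure.map_map measurable_nuF (measurable_id.prodMap hsc),
      Measure.map_map hKm (hBm.prodMap measurable_id), Measure.map_map
      (measurable_nuF.comp (measurable_id.prodMap hsc)) (MeasurableEquiv.measurable _)]
    congr 1
    ext p j
    cases j with
    | zero => simp [K, B, scons, MeasurableEquiv.prodAssoc, stick]
    | succ j =>
      simp [K, B, scons, MeasurableEquiv.prodAssoc, mul_assoc, stick_succ]
  rw [step1, hA, one_step, ← hB, step2]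

/-- The map from the driving variables to the sequence of local times. -/
noncomputable def Fz (z : ℕ ⊕ ℕ → ℝ) (j : ℕ) : ℝ :=
  √(stick (fun i => z (Sum.inl i)) j / z (Sum.inr j))

lemma measurable_Fz : Measurable Fz := by
  refine measurable_pi_iff.2 fun j => ?_
  unfold Fz
  have h : Measurable fun z : ℕ ⊕ ℕ → ℝ => stick (fun i => z (Sum.inl i)) j :=
    (measurable_stick' j).comp (g := fun U => stick U j)
      (f := fun (z : ℕ ⊕ ℕ → ℝ) (i : ℕ) => z (Sum.inl i))
      (measurable_pi_iff.2 fun i => measurable_pi_apply _)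
  exact (h.div (measurable_pi_apply _)).sqrt

lemma lam_fixed {Ω : Type*} [MeasurableSpace Ω] (P : Measure Ω) [IsProbabilityMeasure P]
    (X : ℕ ⊕ ℕ → Ω → ℝ) (hX : ∀ i, Measurable (X i)) (hind : iIndepFun X P)
    (hW : ∀ j, P.map (X (Sum.inl j)) = bW) (hS : ∀ j, P.map (X (Sum.inr j)) = bS) :
    P.map (fun ω => Fz (fun i => X i ω)) =
      ((bW.prod bS).prod (P.map (fun ω => Fz (fun i => X i ω)))).map gstep := by
  set b : ℕ ⊕ ℕ → ℕ ⊕ ℕ := Sum.map Nat.succ Nat.succ with hb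
  have hbi : Function.Injective b :=
    Function.Injective.sumMap Nat.succ_injective Nat.succ_injective
  have hzm : Measurable fun ω i => X i ω := measurable_pi_iff.2 hX
  have hzm' : Measurable fun ω i => X (b i) ω := measurable_pi_iff.2 fun i => hX _
  have hz : P.map (fun ω i => X (b i) ω) = P.map (fun ω i => X i ω) := by
    rw [(hind.precomp hbi).map_fun_eq_infinitePi_map (fun i => hX (b i)),
      hind.map_fun_eq_infinitePi_map hX]
    congr 1
    ext1 i
    rcases i with i | i
    · exact (hW (i+1)).trans (hW i).symm
    · exact (hS (i+1)).trans (hS i).symm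
  have hi := indep_split hX hind (fun t : Bool => if t then Sum.inl 0 else Sum.inr 0) b (by
    intro k k'
    cases k <;> rcases k' with k' | k' <;> simp [hb])
  have hi2 : IndepFun (fun ω => (X (Sum.inl 0) ω, X (Sum.inr 0) ω))
      (fun ω => Fz (fun i => X (b i) ω)) P := by
    exact hi.comp (φ := fun t : Bool → ℝ => (t true, t false)) (ψ := Fz) (by fun_prop)
      measurable_Fz
  have hpm : Measurable (fun ω => (X (Sum.inl 0) ω, X (Sum.inr 0) ω)) := (hX _).prodMk (hX _)
  have hpair : P.map (fun ω => (X (Sum.inl 0) ω, X (Sum.inr 0) ω)) = bW.prod bS := by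
    rw [(indepFun_iff_map_prod_eq_prod_map_map (hX _).aemeasurable (hX _).aemeasurable).1
      (hind.indepFun (by simp)), hW, hS]
  have hjoint := (indepFun_iff_map_prod_eq_prod_map_map hpm.aemeasurable
    (measurable_Fz.comp hzm').aemeasurable).1 hi2
  have hF : P.map (fun ω => Fz (fun i => X (b i) ω)) = P.map (fun ω => Fz (fun i => X i ω)) := by
    have e1 := Measure.map_map (μ := P) measurable_Fz hzm'
    have e2 := Measure.map_map (μ := P) measurable_Fz hzm
    rw [hz] at e1
    exact e1.symm.trans e2
  have hF' : P.map (Fz ∘ fun ω i => X (b i) ω) = P.map (fun ω => Fz (fun i => X i ω)) := hF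
  rw [← hpair]
  conv_rhs => rw [← hF]
  conv_rhs => rw [show (fun ω => Fz (fun i => X (b i) ω)) = Fz ∘ fun ω i => X (b i) ω from rfl]
  rw [← hjoint, Measure.map_map measurable_gstep (hpm.prodMk (measurable_Fz.comp hzm'))]
  refine Measure.map_congr ?_
  have hlt : ∀ᵐ ω ∂P, X (Sum.inl 0) ω < 1 := by
    have := bW_lt
    rw [← hW 0] at this
    exact ae_of_ae_map (hX _).aemeasurable this
  filter_upwards [hlt] with ω hω
  ext j
  cases j with
  | zero => simp [Fz, gstep, scons, stick]
  | succ j =>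
    simp only [Fz, gstep, scons, stick_succ, Function.comp, hb, Sum.map_inl, Sum.map_inr,
      Nat.succ_eq_add_one]
    rw [mul_div_assoc, Real.sqrt_mul (by linarith)]

noncomputable def Ssum (x : ℕ → ℝ) : ℝ := (∑' j, ENNReal.ofReal (x j)).toReal

lemma measurable_Ssum : Measurable Ssum := by
  unfold Ssum
  refine Measurable.ennreal_toReal ?_
  exact Measurable.tsum fun j => (measurable_pi_apply j).ennreal_ofReal

lemma Ssum_eq {x : ℕ → ℝ} (hx : ∀ j, 0 ≤ x j) : Ssum x = ∑' j, x j := by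
  unfold Ssum
  rw [ENNReal.tsum_toReal_eq (fun _ => ENNReal.ofReal_ne_top)]
  simp [ENNReal.toReal_ofReal, hx]

noncomputable def Hn (x : ℕ → ℝ) : (ℕ → ℝ) × ℝ := (fun j => x j / Ssum x, Ssum x)

lemma measurable_Hn : Measurable Hn := by
  refine Measurable.prodMk ?_ measurable_Ssum
  refine measurable_pi_iff.2 fun j => ?_
  exact (measurable_pi_apply j).div measurable_Ssum

lemma nu_good : ∀ᵐ p ∂(mRay.prod piU), 0 < p.1 ∧ (∀ j, 0 ≤ stick p.2 j) ∧ HasSum (stick p.2) 1 := by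
  have h1 := Measure.quasiMeasurePreserving_fst (μ := mRay) (ν := piU) |>.ae mRay_pos
  have h2 := Measure.quasiMeasurePreserving_snd (μ := mRay) (ν := piU) |>.ae piU_good
  filter_upwards [h1, h2] with p a b
  exact ⟨a, b⟩

lemma nuL_Hn : nuL.map Hn = (piU.map stick).prod mRay := by
  unfold nuL
  rw [Measure.map_map measurable_Hn measurable_nuF]
  have h : (mRay.prod piU).map (Hn ∘ fun p j => p.1 * stick p.2 j) =
      (mRay.prod piU).map (Prod.map stick id ∘ Prod.swap) := by
    refine Measure.map_congr ?_
    filter_upwards [nu_good] with p ⟨h0, h1, h2⟩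
    have hs : Ssum (fun j => p.1 * stick p.2 j) = p.1 := by
      rw [Ssum_eq (fun j => mul_nonneg h0.le (h1 j)), tsum_mul_left, h2.tsum_eq, mul_one]
    simp only [Function.comp, Hn, hs, Prod.map, Prod.swap, id]
    congr 1
    ext j
    field_simp
  rw [h, ← Measure.map_map (measurable_stick.prodMap measurable_id) measurable_swap,
    Measure.prod_swap, ← Measure.map_prod_map _ _ measurable_stick measurable_id, Measure.map_id]

lemma nuL_fin : ∀ᵐ x ∂nuL, ∑' j, ENNReal.ofReal (x j) ≠ ⊤ := by
  unfold nuL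
  rw [ae_map_iff measurable_nuF.aemeasurable]
  · filter_upwards [nu_good] with p ⟨h0, h1, h2⟩
    exact (h2.mul_left p.1).summable.tsum_ofReal_ne_top
  · refine (MeasurableSet.singleton ⊤).compl.preimage ?_
    exact Measurable.tsum fun j => (measurable_pi_apply j).ennreal_ofReal

/-- Corollary 4.3 of Aldous–Pitman in the Brownian case `α = 1/2`: if `(Q_j)` is a
GEM(1/2) stick-breaking sequence and `(σ_j)` are i.i.d. stable(1/2) variables, all
jointly independent, then `L := Σ_j √(Q_j/σ_j)` is finite a.s. with
`P(L > ℓ) = e^{-ℓ²/2}`, and the normalized sequence `(L_j/L)` is independent of `L`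
with the GEM(1) (uniform stick-breaking) distribution. -/
theorem stmt_10 {Ω : Type*} [MeasurableSpace Ω] (P : Measure Ω) [IsProbabilityMeasure P]
    (W σ : ℕ → Ω → ℝ)
    (hWmeas : ∀ j, Measurable (W j)) (hσmeas : ∀ j, Measurable (σ j))
    (hindep : iIndepFun (m := fun _ : ℕ ⊕ ℕ => (inferInstance : MeasurableSpace ℝ))
      (Sum.elim W σ) P)
    (hW : ∀ j, P.map (W j) = volume.withDensity fun w =>
      ENNReal.ofReal (Set.indicator (Set.Ioo (0:ℝ) 1)
        (fun w => (1/2) * (1 - w) ^ (-(1:ℝ)/2)) w))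
    (hσ : ∀ j, P.map (σ j) = volume.withDensity fun s =>
      ENNReal.ofReal (Set.indicator (Set.Ioi (0:ℝ))
        (fun s => (2 * π) ^ (-(1:ℝ)/2) * s ^ (-(3:ℝ)/2) * Real.exp (-1 / (2 * s))) s))
    (Q Lseq : ℕ → Ω → ℝ) (L : Ω → ℝ)
    (hQ : ∀ j ω, Q j ω = W j ω * ∏ i ∈ Finset.range j, (1 - W i ω))
    (hLseq : ∀ j ω, Lseq j ω = Real.sqrt (Q j ω / σ j ω))
    (hL : ∀ ω, L ω = ∑' j, Lseq j ω) :
    (∀ᵐ ω ∂P, Summable fun j => Lseq j ω) ∧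
    (∀ ℓ : ℝ, 0 ≤ ℓ → P {ω | ℓ < L ω} = ENNReal.ofReal (Real.exp (-ℓ ^ 2 / 2))) ∧
    IndepFun (fun ω => fun j : ℕ => Lseq j ω / L ω) L P ∧
    (∃ (Ω' : Type) (_ : MeasurableSpace Ω') (P' : Measure Ω') (U : ℕ → Ω' → ℝ),
      IsProbabilityMeasure P' ∧
      iIndepFun (m := fun _ : ℕ => (inferInstance : MeasurableSpace ℝ)) U P' ∧
      (∀ j, P'.map (U j) = volume.restrict (Set.Ioo (0:ℝ) 1)) ∧
      P.map (fun ω => fun j : ℕ => Lseq j ω / L ω) =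
        P'.map (fun ω' => fun j : ℕ => U j ω' * ∏ i ∈ Finset.range j, (1 - U i ω'))) := by
  set X : ℕ ⊕ ℕ → Ω → ℝ := Sum.elim W σ with hXd
  have hX : ∀ i, Measurable (X i) := by
    rintro (i | i)
    · exact hWmeas i
    · exact hσmeas i
  have hW' : ∀ j, P.map (X (Sum.inl j)) = bW := hW
  have hS' : ∀ j, P.map (X (Sum.inr j)) = bS := hσ
  have : IsProbabilityMeasure bW := by
    rw [← hW' 0]; exact Measure.isProbabilityMeasure_map (hX _).aemeasurable
  have : IsProbabilityMeasure bS := by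
    rw [← hS' 0]; exact Measure.isProbabilityMeasure_map (hX _).aemeasurable
  have hzm : Measurable fun ω i => X i ω := measurable_pi_iff.2 hX
  have hFm : Measurable fun ω => Fz (fun i => X i ω) := measurable_Fz.comp hzm
  have : IsProbabilityMeasure (P.map (fun ω => Fz (fun i => X i ω))) :=
    Measure.isProbabilityMeasure_map hFm.aemeasurable
  have hlam : P.map (fun ω => Fz (fun i => X i ω)) = nuL :=
    fixed_unique (lam_fixed P X hX hindep hW' hS') nu_fixed
  have hLF : ∀ ω, (fun j => Lseq j ω) = Fz (fun i => X i ω) := by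
    intro ω
    ext j
    rw [hLseq, hQ]
    rfl
  have hnn : ∀ ω j, 0 ≤ Lseq j ω := fun ω j => by rw [hLseq]; exact Real.sqrt_nonneg _
  have hLS : ∀ ω, L ω = Ssum (Fz (fun i => X i ω)) := by
    intro ω
    rw [← hLF, Ssum_eq (hnn ω), hL]
  have hLm : Measurable L := by
    rw [show L = _ from funext hLS]
    exact measurable_Ssum.comp hFm
  have hNe : (fun ω => ((fun j : ℕ => Lseq j ω / L ω), L ω)) =
      fun ω => Hn (Fz (fun i => X i ω)) := by
    ext1 ω
    rw [← hLF, Hn, hLF, ← hLS]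
  have hNm : Measurable fun ω => (fun j : ℕ => Lseq j ω / L ω) := by
    have : Measurable (fun ω => ((fun j : ℕ => Lseq j ω / L ω), L ω)) := by
      rw [hNe]; exact measurable_Hn.comp hFm
    exact measurable_fst.comp this
  have hjoint : P.map (fun ω => ((fun j : ℕ => Lseq j ω / L ω), L ω)) =
      (piU.map stick).prod mRay := by
    rw [hNe, ← nuL_Hn, ← hlam, Measure.map_map measurable_Hn hFm]
    rfl
  have : IsProbabilityMeasure (piU.map stick) :=
    Measure.isProbabilityMeasure_map measurable_stick.aemeasurable
  have hm1 : P.map (fun ω => (fun j : ℕ => Lseq j ω / L ω)) = piU.map stick := by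
    have := congrArg (Measure.map Prod.fst) hjoint
    rw [Measure.map_map measurable_fst (hNm.prodMk hLm), Measure.map_fst_prod] at this
    simpa [Function.comp_def] using this
  have hm2 : P.map L = mRay := by
    have := congrArg (Measure.map Prod.snd) hjoint
    rw [Measure.map_map measurable_snd (hNm.prodMk hLm), Measure.map_snd_prod] at this
    simpa [Function.comp_def] using this
  refine ⟨?_, ?_, ?_, ?_⟩
  · have h := nuL_fin
    rw [← hlam] at h
    filter_upwards [ae_of_ae_map hFm.aemeasurable h] with ω hω
    rw [← hLF] at hω
    have := ENNReal.summable_toReal hω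
    simpa [ENNReal.toReal_ofReal, hnn] using this
  · intro l hl
    rw [← mRay_tail hl, ← hm2, Measure.map_apply hLm measurableSet_Ioi]
    rfl
  · rw [indepFun_iff_map_prod_eq_prod_map_map hNm.aemeasurable hLm.aemeasurable, hm1, hm2]
    exact hjoint
  · exact ⟨ℕ → ℝ, inferInstance, piU, fun j U => U j, inferInstance, piU_indep, piU_eval, hm1⟩
end

section
/- Let k ≥ 1 and let λ_1, ..., λ_k be strictly positive real numbers. Then the sum over all permutations σ of {1,...,k} of the product ∏_{j=1}^{k} ( λ_{σ(j)} / Σ_{i=j}^{k} λ_{σ(i)} ) equals 1. -/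
theorem stmt_11_aux (k : ℕ) : ∀ (lam : Fin k → ℝ) (_ : ∀ i, 0 < lam i),
    ∑ σ : Equiv.Perm (Fin k),
        ∏ j : Fin k, lam (σ j) / ∑ i ∈ Finset.Ici j, lam (σ i) = 1 := by
  induction k with
  | zero => intro lam _; simp
  | succ n ih =>
    intro lam hlam
    have hS : 0 < ∑ i, lam i := Finset.sum_pos (fun i _ => hlam i) Finset.univ_nonempty
    rw [← Equiv.sum_comp Equiv.Perm.decomposeFin.symm, Fintype.sum_prod_type]
    have key : ∀ p : Fin (n + 1), ∑ e : Equiv.Perm (Fin n),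
        ∏ j : Fin (n + 1), lam (Equiv.Perm.decomposeFin.symm (p, e) j) /
          ∑ i ∈ Finset.Ici j, lam (Equiv.Perm.decomposeFin.symm (p, e) i)
        = lam p / ∑ i, lam i := by
      intro p
      have h := ih (fun x => lam (Equiv.swap 0 p x.succ)) (fun x => hlam _)
      rw [← mul_one (lam p / _), ← h, Finset.mul_sum]
      refine Finset.sum_congr rfl fun e _ => ?_
      rw [Fin.prod_univ_succ]
      congr 1
      · have h0 : Finset.Ici (0 : Fin (n + 1)) = Finset.univ := by
          ext x; simp
        rw [h0, Equiv.sum_comp (Equiv.Perm.decomposeFin.symm (p, e)) lam,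
          Equiv.Perm.decomposeFin_symm_apply_zero]
      · refine Finset.prod_congr rfl fun j _ => ?_
        have h1 : Finset.Ici j.succ = (Finset.Ici j).map (Fin.succEmb n) := by
          ext x
          refine Fin.cases ?_ (fun y => ?_) x <;> simp
        rw [h1, Finset.sum_map]
        simp only [Fin.coe_succEmb, Equiv.Perm.decomposeFin_symm_apply_succ]
    rw [Finset.sum_congr rfl (fun p _ => key p), ← Finset.sum_div, div_self (ne_of_gt hS)]


/-- The size-biased sampling identity from the proof of Lemma 6.4 of Aldous–Pitman:
summing over all permutations `σ` of `{1,…,k}` the product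
`∏_j λ_{σ(j)} / (λ_{σ(j)} + ⋯ + λ_{σ(k)})` gives `1`. -/
theorem stmt_11 (k : ℕ) (hk : 1 ≤ k) (lam : Fin k → ℝ) (hlam : ∀ i, 0 < lam i) :
    ∑ σ : Equiv.Perm (Fin k),
        ∏ j : Fin k, lam (σ j) / ∑ i ∈ Finset.Ici j, lam (σ i) = 1 := by
  exact stmt_11_aux k lam hlam
end
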